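/- Suppose g ≥ 4. For every choice of integer weights λ_0,…,λ_{2g−2} and ν_0,…,ν_{g−3} with Σ_i λ_i + Σ_j ν_j = 0, there exists a monomial basis of V_2 of nonpositive weight. (By the Kempf–Morrison criterion, this is the combinatorial content of Corollary 5.12: the 2nd Hilbert point of the bicanonically embedded Wiman curve of genus g ≥ 4 is semistable.) -/

import Mathlib

/-!
The combinatorial content of Corollary 5.12 (semistability of the 2nd Hilbert point of
the bicanonically embedded Wiman curve of genus `g ≥ 4`): for every choice of integer
weights `λ₀,…,λ_{2g−2}` and `ν₀,…,ν_{g−3}` with total sum `0`, there exists a monomial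
basis of `V₂` of nonpositive weight.
We work in `R = ℂ[z,w]/(w² − z^(2g+1) − 1)` with `x_i = z^i` and `y_j = z^j·w`.
-/

noncomputable section

/-- The coordinate ring `R = ℂ[z,w]/(w² − z^(2g+1) − 1)` of the Wiman curve. -/
abbrev WRing (g : ℕ) : Type :=
  MvPolynomial (Fin 2) ℂ ⧸
    Ideal.span ({MvPolynomial.X 1 ^ 2 - MvPolynomial.X 0 ^ (2 * g + 1) - 1} :
      Set (MvPolynomial (Fin 2) ℂ))

/-- The image of `z` in `R`. -/
def zW (g : ℕ) : WRing g := Ideal.Quotient.mk _ (MvPolynomial.X 0)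

/-- The image of `w` in `R`. -/
def wW (g : ℕ) : WRing g := Ideal.Quotient.mk _ (MvPolynomial.X 1)

/-- Index type for the `3g−3` bicanonical variables `x₀,…,x_{2g−2}, y₀,…,y_{g−3}`. -/
abbrev WIdx (g : ℕ) : Type := Fin (2 * g - 1) ⊕ Fin (g - 2)

/-- The bicanonical variables: `x_i = z^i` and `y_j = z^j·w`. -/
def varW (g : ℕ) : WIdx g → WRing g :=
  Sum.elim (fun i => zW g ^ (i : ℕ)) (fun j => zW g ^ (j : ℕ) * wW g)

/-- `V_m`: the `ℂ`-span of all degree-`m` monomials in the variables `x_i, y_j`. -/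
def VW (g m : ℕ) : Submodule ℂ (WRing g) :=
  Submodule.span ℂ
    {r : WRing g | ∃ σ : Multiset (WIdx g), Multiset.card σ = m ∧ r = (σ.map (varW g)).prod}

/-- Degree-`m` monomials, as multisets of `m` variable indices. -/
abbrev WDegMon (g m : ℕ) := Sym (WIdx g) m

/-- A finite set of degree-`m` monomials is a monomial basis of `V_m` if its images in
`R` are linearly independent over `ℂ` and span `V_m`. -/
def IsMonBasisW (g m : ℕ) (S : Finset (WDegMon g m)) : Prop :=
  LinearIndependent ℂ (fun s : S => (((s : WDegMon g m)).1.map (varW g)).prod) ∧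
  Submodule.span ℂ ((fun s : WDegMon g m => (s.1.map (varW g)).prod) '' S) = VW g m

open Finset

theorem sum_le_staircase (m : ℕ) {M f : ℕ → ℤ}
    (h : ∀ i j, i ≤ m → j ≤ m → M (i + j) ≤ f i + f j) :
    ∑ k ∈ range (2 * m + 1), M k ≤ 4 * ∑ i ∈ range (m + 1), f i - f 0 - f m := by
  induction m with
  | zero => simpa using (h 0 0 le_rfl le_rfl).trans (by linarith)
  | succ m ih =>
    have ih' := ih fun i j hi hj => h i j (by omega) (by omega)
    have h1 := h m (m + 1) (by omega) le_rfl
    have h2 := h (m + 1) (m + 1) le_rfl le_rfl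
    rw [show 2 * (m + 1) + 1 = 2 * m + 1 + 1 + 1 by ring, sum_range_succ, sum_range_succ,
      sum_range_succ _ (m + 1)]
    rw [show m + (m + 1) = 2 * m + 1 by ring] at h1
    rw [show m + 1 + (m + 1) = 2 * m + 1 + 1 by ring] at h2
    linarith

theorem sum_le_star (m : ℕ) {M f : ℕ → ℤ}
    (h : ∀ i j, i ≤ m → j ≤ m → M (i + j) ≤ f i + f j) :
    ∑ k ∈ range (2 * m + 1), M k ≤ 2 * ∑ i ∈ range (m + 1), f i + m * (f 0 + f m) := by
  have h1 : ∑ k ∈ range (m + 1), M k ≤ ∑ k ∈ range (m + 1), (f 0 + f k) :=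
    sum_le_sum fun k hk => by
      have := h 0 k (by omega) (by rw [mem_range] at hk; omega)
      rwa [zero_add] at this
  have h2 : ∑ k ∈ range m, M (m + 1 + k) ≤ ∑ k ∈ range m, (f m + f (k + 1)) :=
    sum_le_sum fun k hk => by
      rw [mem_range] at hk
      have := h m (k + 1) le_rfl (by omega)
      rwa [show m + (k + 1) = m + 1 + k by ring] at this
  have h3 := sum_range_succ' f m
  rw [show 2 * m + 1 = m + 1 + m by ring, sum_range_add]
  simp only [sum_add_distrib, sum_const, card_range, nsmul_eq_mul] at h1 h2
  push_cast at h1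
  linarith

/-- Averaging over all pairs `(a + i, a + t - i)` with a fixed index sum. -/
theorem mul_le_two_sum {M f : ℕ → ℤ} (a t : ℕ)
    (h : ∀ i ≤ t, M (2 * a + t) ≤ f (a + i) + f (a + (t - i))) :
    ((t : ℤ) + 1) * M (2 * a + t) ≤ 2 * ∑ i ∈ range (t + 1), f (a + i) := by
  have h1 : ∑ _i ∈ range (t + 1), M (2 * a + t) ≤
      ∑ i ∈ range (t + 1), (f (a + i) + f (a + (t - i))) :=
    sum_le_sum fun i hi => h i (by rw [mem_range] at hi; omega)
  have h2 := sum_range_reflect (fun i => f (a + i)) (t + 1)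
  simp only [Nat.add_sub_cancel] at h2
  rw [sum_add_distrib, sum_const, card_range, nsmul_eq_mul, h2] at h1
  push_cast at h1
  linarith

theorem sum_range_two_mul_add_one {G : Type*} [AddCommMonoid G] (f : ℕ → G) (m : ℕ) :
    ∑ i ∈ range (2 * m + 1), f i =
      ∑ i ∈ range (m + 1), f (2 * i) + ∑ i ∈ range m, f (2 * i + 1) := by
  induction m with
  | zero => simp
  | succ m ih =>
    rw [show 2 * (m + 1) + 1 = 2 * m + 1 + 1 + 1 by ring, sum_range_succ, sum_range_succ, ih,
      sum_range_succ (fun i => f (2 * i)) (m + 1), sum_range_succ (fun i => f (2 * i + 1)) m,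
      show 2 * (m + 1) = 2 * m + 1 + 1 by ring]
    abel

theorem sum_range_three_mul {G : Type*} [AddCommMonoid G] (f : ℕ → G) (m : ℕ) :
    ∑ k ∈ range (3 * m), f k =
      ∑ j ∈ range m, (f (3 * j) + f (3 * j + 1) + f (3 * j + 2)) := by
  induction m with
  | zero => simp
  | succ m ih =>
    rw [show 3 * (m + 1) = 3 * m + 1 + 1 + 1 by ring, sum_range_succ, sum_range_succ,
      sum_range_succ, ih, sum_range_succ _ m]
    ac_rfl

section Mixed

variable {n : ℕ} {P l y : ℕ → ℤ}

/-- The staircase whose rows have three entries, except for row `p`, which has five. -/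
theorem sum_mixed_le_even (h : ∀ i j, i ≤ 2 * n + 2 → j < n → P (i + j) ≤ l i + y j)
    {p : ℕ} (hp : p < n) :
    ∑ k ∈ range (3 * n + 2), P k ≤
      2 * ∑ i ∈ range (n + 2), l (2 * i) + ∑ i ∈ range (n + 1), l (2 * i + 1)
        - l 0 - l (2 * n + 2) - l (2 * (p + 1)) + 3 * ∑ j ∈ range n, y j + 2 * y p := by
  obtain ⟨q, rfl⟩ : ∃ q, n = p + 1 + q := ⟨n - p - 1, by omega⟩
  have key : ∀ i j k, i + j = k → i ≤ 2 * (p + 1 + q) + 2 → j < p + 1 + q → P k ≤ l i + y j := by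
    rintro i j k rfl; exact h i j
  have h1 : ∑ k ∈ range (3 * p), P k ≤
      ∑ j ∈ range p, (l (2 * j) + l (2 * j + 1) + l (2 * (j + 1)) + 3 * y j) := by
    rw [sum_range_three_mul]
    refine sum_le_sum fun j hj => ?_
    rw [mem_range] at hj
    linarith [key (2 * j) j (3 * j) (by omega) (by omega) (by omega),
      key (2 * j + 1) j (3 * j + 1) (by omega) (by omega) (by omega),
      key (2 * (j + 1)) j (3 * j + 2) (by omega) (by omega) (by omega)]
  have h2 : ∑ k ∈ range (3 * q), P (3 * p + 4 + 1 + k) ≤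
      ∑ j ∈ range q, (l (2 * (p + 2 + j)) + l (2 * (p + 2 + j) + 1) + l (2 * (p + 2 + (j + 1)))
        + 3 * y (p + 1 + j)) := by
    rw [sum_range_three_mul]
    refine sum_le_sum fun j hj => ?_
    rw [mem_range] at hj
    linarith [key (2 * (p + 2 + j)) (p + 1 + j) (3 * p + 4 + 1 + 3 * j)
        (by omega) (by omega) (by omega),
      key (2 * (p + 2 + j) + 1) (p + 1 + j) (3 * p + 4 + 1 + (3 * j + 1))
        (by omega) (by omega) (by omega),
      key (2 * (p + 2 + (j + 1))) (p + 1 + j) (3 * p + 4 + 1 + (3 * j + 2))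
        (by omega) (by omega) (by omega)]
  have m0 := key (2 * p) p (3 * p) (by omega) (by omega) (by omega)
  have m1 := key (2 * p + 1) p (3 * p + 1) (by omega) (by omega) (by omega)
  have m2 := key (2 * (p + 1)) p (3 * p + 2) (by omega) (by omega) (by omega)
  have m3 := key (2 * (p + 1) + 1) p (3 * p + 3) (by omega) (by omega) (by omega)
  have m4 := key (2 * (p + 2)) p (3 * p + 4) (by omega) (by omega) (by omega)
  have e1 := sum_range_succ' (fun j => l (2 * j)) p
  have e2 := sum_range_succ' (fun j => l (2 * (p + 2 + j))) q
  have e3 := sum_range_succ (fun j => l (2 * j)) p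
  have e4 := sum_range_succ (fun j => l (2 * (p + 2 + j))) q
  rw [show 3 * (p + 1 + q) + 2 = 3 * p + 4 + 1 + 3 * q by ring,
    sum_range_add _ (3 * p + 4 + 1), show p + 1 + q + 2 = p + 2 + (q + 1) by ring,
    sum_range_add _ (p + 2),
    show p + 1 + q + 1 = p + 2 + q by ring, sum_range_add _ (p + 2), sum_range_add _ (p + 1),
    show 2 * (p + 1 + q) + 2 = 2 * (p + 2 + q) by ring]
  rw [sum_range_succ _ (3 * p + 4), sum_range_succ _ (3 * p + 3), sum_range_succ _ (3 * p + 2),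
    sum_range_succ _ (3 * p + 1), sum_range_succ _ (3 * p), sum_range_succ _ (p + 1),
    sum_range_succ _ (p + 1), sum_range_succ _ p, sum_range_succ _ p, sum_range_succ _ p]
  simp only [sum_add_distrib, ← mul_sum, mul_zero, add_zero] at h1 h2 e1 e2 e3 e4 ⊢
  linarith

/-- The staircase in which every odd column has two entries, except for the columns `2 * p + 1`
and `2 * p + 3`. -/
theorem sum_mixed_le_odd (h : ∀ i j, i ≤ 2 * n + 2 → j < n → P (i + j) ≤ l i + y j)
    {p : ℕ} (hp : p < n) :
    ∑ k ∈ range (3 * n + 2), P k ≤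
      ∑ i ∈ range (n + 2), l (2 * i) + 2 * ∑ i ∈ range (n + 1), l (2 * i + 1)
        - l (2 * p + 1) - l (2 * (p + 1) + 1) + 3 * ∑ j ∈ range n, y j
        - y 0 - y (n - 1) + 4 * y p := by
  obtain ⟨q, rfl⟩ : ∃ q, n = p + 1 + q := ⟨n - p - 1, by omega⟩
  have key : ∀ i j k, i + j = k → i ≤ 2 * (p + 1 + q) + 2 → j < p + 1 + q → P k ≤ l i + y j := by
    rintro i j k rfl; exact h i j
  have h1 : ∑ k ∈ range (3 * p), P (1 + k) ≤
      ∑ j ∈ range p, (2 * l (2 * j + 1) + l (2 * (j + 1)) + y j + 2 * y (j + 1)) := by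
    rw [sum_range_three_mul]
    refine sum_le_sum fun j hj => ?_
    rw [mem_range] at hj
    linarith [key (2 * j + 1) j (1 + 3 * j) (by omega) (by omega) (by omega),
      key (2 * j + 1) (j + 1) (1 + (3 * j + 1)) (by omega) (by omega) (by omega),
      key (2 * (j + 1)) (j + 1) (1 + (3 * j + 2)) (by omega) (by omega) (by omega)]
  have h2 : ∑ k ∈ range (3 * q), P (1 + 3 * p + 4 + k) ≤
      ∑ j ∈ range q, (2 * l (2 * (p + 2 + j) + 1) + l (2 * (p + 3 + j))
        + y (p + j) + 2 * y (p + (j + 1))) := by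
    rw [sum_range_three_mul]
    refine sum_le_sum fun j hj => ?_
    rw [mem_range] at hj
    linarith [key (2 * (p + 2 + j) + 1) (p + j) (1 + 3 * p + 4 + 3 * j)
        (by omega) (by omega) (by omega),
      key (2 * (p + 2 + j) + 1) (p + (j + 1)) (1 + 3 * p + 4 + (3 * j + 1))
        (by omega) (by omega) (by omega),
      key (2 * (p + 3 + j)) (p + (j + 1)) (1 + 3 * p + 4 + (3 * j + 2))
        (by omega) (by omega) (by omega)]
  have m0 := key 0 0 0 (by omega) (by omega) (by omega)
  have m1 := key (2 * p + 1) p (1 + 3 * p) (by omega) (by omega) (by omega)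
  have m2 := key (2 * (p + 1)) p (1 + 3 * p + 1) (by omega) (by omega) (by omega)
  have m3 := key (2 * (p + 1) + 1) p (1 + 3 * p + 2) (by omega) (by omega) (by omega)
  have m4 := key (2 * (p + 2)) p (1 + 3 * p + 3) (by omega) (by omega) (by omega)
  have e1 := sum_range_succ' (fun j => l (2 * j)) p
  have e2 := sum_range_succ' y p
  have e3 := sum_range_succ y p
  have e4 := sum_range_succ' (fun j => y (p + j)) q
  have e5 := sum_range_succ (fun j => y (p + j)) q
  have e6 := sum_range_add y p (q + 1)
  have e7 := sum_range_succ (fun j => l (2 * j)) p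
  rw [show 3 * (p + 1 + q) + 2 = 1 + 3 * p + 4 + 3 * q by ring, sum_range_add,
    show p + 1 + q + 2 = p + 3 + q by ring, sum_range_add _ (p + 3),
    show p + 1 + q + 1 = p + 2 + q by ring, sum_range_add _ (p + 2),
    show p + 1 + q - 1 = p + q by omega, show p + 1 + q = p + (q + 1) by ring, e6]
  rw [sum_range_succ _ (1 + 3 * p + 3), sum_range_succ _ (1 + 3 * p + 2),
    sum_range_succ _ (1 + 3 * p + 1), sum_range_succ _ (1 + 3 * p), sum_range_add,
    sum_range_one, sum_range_succ _ (p + 2), sum_range_succ _ (p + 1),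
    sum_range_succ _ (p + 1), sum_range_succ _ p, sum_range_succ _ p]
  simp only [sum_add_distrib, ← mul_sum, mul_zero, add_zero] at h1 h2 e1 e2 e3 e4 e5 e7 ⊢
  linarith

/-- The staircase in which every odd column has two entries, except for the first and the last. -/
theorem sum_mixed_le_outer (h : ∀ i j, i ≤ 2 * n + 2 → j < n → P (i + j) ≤ l i + y j)
    (hn : 0 < n) :
    ∑ k ∈ range (3 * n + 2), P k ≤
      ∑ i ∈ range (n + 2), l (2 * i) + 2 * ∑ i ∈ range (n + 1), l (2 * i + 1)
        - l 1 - l (2 * n + 1) + 3 * ∑ j ∈ range n, y j + y 0 + y (n - 1) := by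
  obtain ⟨q, rfl⟩ : ∃ q, n = q + 1 := ⟨n - 1, by omega⟩
  have key : ∀ i j k, i + j = k → i ≤ 2 * (q + 1) + 2 → j < q + 1 → P k ≤ l i + y j := by
    rintro i j k rfl; exact h i j
  have h1 : ∑ k ∈ range (3 * q), P (3 + k) ≤
      ∑ j ∈ range q, (2 * l (2 * (1 + j) + 1) + l (2 * (2 + j)) + y j + 2 * y (j + 1)) := by
    rw [sum_range_three_mul]
    refine sum_le_sum fun j hj => ?_
    rw [mem_range] at hj
    linarith [key (2 * (1 + j) + 1) j (3 + 3 * j) (by omega) (by omega) (by omega),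
      key (2 * (1 + j) + 1) (j + 1) (3 + (3 * j + 1)) (by omega) (by omega) (by omega),
      key (2 * (2 + j)) (j + 1) (3 + (3 * j + 2)) (by omega) (by omega) (by omega)]
  have m0 := key 0 0 0 (by omega) (by omega) (by omega)
  have m1 := key 1 0 1 (by omega) (by omega) (by omega)
  have m2 := key 2 0 2 (by omega) (by omega) (by omega)
  have m3 := key (2 * (1 + q) + 1) q (3 + 3 * q) (by omega) (by omega) (by omega)
  have m4 := key (2 * (2 + q)) q (3 + 3 * q + 1) (by omega) (by omega) (by omega)
  have e2 := sum_range_succ' y q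
  have e3 := sum_range_succ y q
  have e4 := sum_range_succ (fun j => l (2 * (1 + j) + 1)) q
  have e5 := sum_range_succ (fun j => l (2 * (2 + j))) q
  rw [show 3 * (q + 1) + 2 = 3 + 3 * q + 1 + 1 by ring, sum_range_succ, sum_range_succ,
    sum_range_add, show q + 1 + 2 = 2 + (q + 1) by ring, sum_range_add _ 2,
    show q + 1 + 1 = 1 + (q + 1) by ring, sum_range_add _ 1,
    show q + 1 - 1 = q by omega, show 2 * (q + 1) + 1 = 2 * (1 + q) + 1 by ring]
  simp only [sum_add_distrib, ← mul_sum, sum_range_succ _ 0, sum_range_succ _ 1,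
    sum_range_succ _ 2, sum_range_zero, mul_zero, mul_one, zero_add] at h1 e2 e3 e4 e5 ⊢
  linarith

theorem mul_sum_mixed_le (h : ∀ i j, i ≤ 2 * n + 2 → j < n → P (i + j) ≤ l i + y j)
    (hn : 0 < n) :
    (2 * n + 1 : ℤ) * ∑ k ∈ range (3 * n + 2), P k ≤
      3 * n * ∑ i ∈ range (2 * n + 3), l i - (n - 1) * (l 0 + l (2 * n + 2))
        + (6 * n + 9) * ∑ j ∈ range n, y j - (n - 1) * (y 0 + y (n - 1)) := by
  have h1 := sum_le_sum fun p hp => sum_mixed_le_even h (mem_range.1 hp)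
  have h2 := sum_le_sum fun p hp => sum_mixed_le_odd h (mem_range.1 hp)
  have h3 := sum_mixed_le_outer h hn
  have e1 := sum_range_two_mul_add_one l (n + 1)
  have e2 := sum_range_succ (fun p => l (2 * (p + 1))) n
  have e3 := sum_range_succ' (fun p => l (2 * p)) (n + 1)
  have e4 := sum_range_succ (fun p => l (2 * p + 1)) n
  have e5 := sum_range_succ' (fun p => l (2 * p + 1)) n
  rw [show 2 * (n + 1) + 1 = 2 * n + 3 by ring] at e1
  simp only [sum_add_distrib, sum_sub_distrib, ← mul_sum, sum_const, card_range, nsmul_eq_mul,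
    mul_zero, zero_add] at h1 h2 e2 e3 e4 e5
  rw [show 2 * (n + 1) = 2 * n + 2 by ring] at e2
  nlinarith [h1, h2, h3]

end Mixed

section Even

variable {n : ℕ} {M l : ℕ → ℤ}

theorem mul_sum_odd_le (h : ∀ i j, i ≤ 2 * n + 2 → j ≤ 2 * n + 2 → M (i + j) ≤ l i + l j)
    (hn : 0 < n) :
    (2 * n + 1 : ℤ) * (2 * n + 3) * (∑ i ∈ range (2 * n + 2), M (2 * i + 1) + M (2 * n)
        + M (2 * n + 2) + M (2 * n + 4) + M (4 * n + 4)) ≤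
      (2 * n + 1) * (2 * n + 3) * (2 * ∑ i ∈ range (2 * n + 3), l i - l 0 + l (2 * n + 2))
        + (2 * n + 3) * (4 * ∑ i ∈ range (2 * n + 3), l i - 2 * l 0 - 2 * l (2 * n + 2))
        + (2 * n - 1) * (2 * ∑ i ∈ range (2 * n + 3), l i) := by
  have h1 : ∑ i ∈ range (2 * n + 2), M (2 * i + 1) ≤
      ∑ i ∈ range (2 * n + 2), (l i + l (i + 1)) := sum_le_sum fun i hi => by
    rw [mem_range] at hi
    rw [show 2 * i + 1 = i + (i + 1) by ring]
    exact h _ _ (by omega) (by omega)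
  have h2 := mul_le_two_sum (M := M) (f := l) 0 (2 * n) fun i hi => by
    rw [show 2 * 0 + 2 * n = (0 + i) + (0 + (2 * n - i)) by omega]
    exact h _ _ (by omega) (by omega)
  have h3 := mul_le_two_sum (M := M) (f := l) 0 (2 * n + 2) fun i hi => by
    rw [show 2 * 0 + (2 * n + 2) = (0 + i) + (0 + (2 * n + 2 - i)) by omega]
    exact h _ _ (by omega) (by omega)
  have h4 := mul_le_two_sum (M := M) (f := l) 2 (2 * n) fun i hi => by
    rw [show 2 * 2 + 2 * n = (2 + i) + (2 + (2 * n - i)) by omega]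
    exact h _ _ (by omega) (by omega)
  have h5 := h 1 (2 * n + 1) (by omega) (by omega)
  have h6 := h (2 * n + 2) (2 * n + 2) le_rfl le_rfl
  have e1 := sum_range_succ l (2 * n + 2)
  have e2 := sum_range_succ' l (2 * n + 2)
  have e3 := sum_range_succ l (2 * n + 1)
  have e4 := sum_range_add l 2 (2 * n + 1)
  rw [show 2 + (2 * n + 1) = 2 * n + 3 by ring] at e4
  rw [show 2 * 2 + 2 * n = 2 * n + 4 by ring] at h4
  rw [show 1 + (2 * n + 1) = 2 * n + 2 by ring] at h5
  rw [show 2 * n + 2 + (2 * n + 2) = 4 * n + 4 by ring] at h6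
  rw [sum_add_distrib] at h1
  push_cast at h2 h3 h4
  simp only [zero_add, sum_range_succ _ 1, sum_range_one] at h2 h3 h4 e1 e2 e3 e4
  have p1 := mul_le_mul_of_nonneg_left h1 (show (0 : ℤ) ≤ (2 * n + 1) * (2 * n + 3) by positivity)
  have p2 := mul_le_mul_of_nonneg_left h2 (show (0 : ℤ) ≤ 2 * n + 3 by positivity)
  have p3 := mul_le_mul_of_nonneg_left h3 (show (0 : ℤ) ≤ 2 * n - 1 by omega)
  have p4 := mul_le_mul_of_nonneg_left h4 (show (0 : ℤ) ≤ 2 * n + 3 by positivity)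
  have p5 := mul_le_mul_of_nonneg_left h5 (show (0 : ℤ) ≤ 2 * (2 * n + 3) by positivity)
  have p6 := mul_le_mul_of_nonneg_left h6 (show (0 : ℤ) ≤ (2 * n + 1) * (2 * n + 3) by positivity)
  set A := ∑ i ∈ range (2 * n + 3), l i
  rw [show ∑ k ∈ range (2 * n + 2), l (k + 1) = A - l 0 by linarith,
    show ∑ k ∈ range (2 * n + 2), l k = A - l (2 * n + 2) by linarith] at p1
  rw [show ∑ k ∈ range (2 * n + 1), l k = A - l (2 * n + 2) - l (2 * n + 1) by linarith] at p2
  rw [show ∑ k ∈ range (2 * n + 1), l (2 + k) = A - l 0 - l 1 by linarith] at p4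
  linarith

theorem mul_sum_low_le (h : ∀ i j, i ≤ 2 * n + 2 → j ≤ 2 * n + 2 → M (i + j) ≤ l i + l j)
    (hn : 0 < n) :
    (2 * n + 1 : ℤ) * (n + 1) * (∑ k ∈ range (2 * n + 5), M k + M (4 * n + 4)) ≤
      (2 * n + 1) * (n + 1) *
          ((2 * n + 3) * l 0 + ∑ i ∈ range (2 * n + 3), l i + 2 * l (2 * n + 2))
        + (n + 1) * (2 * ∑ i ∈ range (2 * n + 3), l i - 2 * l 0 + 2 * l (2 * n + 2))
        + (2 * n - 1) * (∑ i ∈ range (2 * n + 3), l i - l 0) := by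
  have h1 : ∑ k ∈ range (2 * n + 3), M k ≤ ∑ k ∈ range (2 * n + 3), (l 0 + l k) :=
    sum_le_sum fun k hk => by
      rw [mem_range] at hk
      have := h 0 k (by omega) (by omega)
      rwa [zero_add] at this
  have h3 := mul_le_two_sum (M := M) (f := l) 1 (2 * n + 1) fun i hi => by
    rw [show 2 * 1 + (2 * n + 1) = (1 + i) + (1 + (2 * n + 1 - i)) by omega]
    exact h _ _ (by omega) (by omega)
  have h4 := mul_le_two_sum (M := M) (f := l) 2 (2 * n) fun i hi => by
    rw [show 2 * 2 + 2 * n = (2 + i) + (2 + (2 * n - i)) by omega]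
    exact h _ _ (by omega) (by omega)
  have h5 := h 1 (2 * n + 2) (by omega) (by omega)
  have h6 := h (2 * n + 2) (2 * n + 2) le_rfl le_rfl
  have e2 := sum_range_add l 1 (2 * n + 2)
  have e4 := sum_range_add l 2 (2 * n + 1)
  rw [show 1 + (2 * n + 2) = 2 * n + 3 by ring] at e2
  rw [show 2 + (2 * n + 1) = 2 * n + 3 by ring] at e4
  rw [show 2 * 1 + (2 * n + 1) = 2 * n + 3 by ring] at h3
  rw [show 2 * 2 + 2 * n = 2 * n + 4 by ring] at h4
  rw [show 1 + (2 * n + 2) = 2 * n + 3 by ring] at h5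
  rw [show 2 * n + 2 + (2 * n + 2) = 4 * n + 4 by ring] at h6
  rw [sum_add_distrib, sum_const, card_range, nsmul_eq_mul] at h1
  push_cast at h1 h3 h4
  simp only [sum_range_succ _ 1, sum_range_one] at e2 e4
  rw [show 2 * n + 5 = 2 * n + 3 + 1 + 1 by ring, sum_range_succ _ (2 * n + 3 + 1),
    sum_range_succ _ (2 * n + 3)]
  have p1 := mul_le_mul_of_nonneg_left h1 (show (0 : ℤ) ≤ (2 * n + 1) * (n + 1) by positivity)
  have p3 := mul_le_mul_of_nonneg_left h3 (show (0 : ℤ) ≤ 2 * n - 1 by omega)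
  have p4 := mul_le_mul_of_nonneg_left h4 (show (0 : ℤ) ≤ n + 1 by positivity)
  have p5 := mul_le_mul_of_nonneg_left h5 (show (0 : ℤ) ≤ 2 * (n + 1) by positivity)
  have p6 := mul_le_mul_of_nonneg_left h6 (show (0 : ℤ) ≤ (2 * n + 1) * (n + 1) by positivity)
  set A := ∑ i ∈ range (2 * n + 3), l i
  rw [show ∑ k ∈ range (2 * n + 1 + 1), l (1 + k) = A - l 0 from eq_sub_of_add_eq' e2.symm] at p3
  rw [show ∑ k ∈ range (2 * n + 1), l (2 + k) = A - l 0 - l 1 by linarith] at p4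
  linarith

end Even

theorem sum_ite_replace_odd {n : ℕ} (hn : 0 < n) (M N : ℕ → ℤ) :
    ∑ k ∈ range (4 * n + 5),
        (if k ∈ {k ∈ range (4 * n + 4) | Even k ∧ (k ≤ 2 * n - 2 ∨ 2 * n + 5 ≤ k)}
          then N (k % (2 * n + 5)) else M k) =
      ∑ i ∈ range (2 * n + 2), M (2 * i + 1) + M (2 * n) + M (2 * n + 2) + M (2 * n + 4)
        + M (4 * n + 4) + ∑ k ∈ range (2 * n - 1), N k := by
  obtain ⟨m, rfl⟩ : ∃ m, n = m + 1 := ⟨n - 1, by omega⟩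
  rw [show 4 * (m + 1) + 5 = 2 * (2 * (m + 1) + 2) + 1 by ring, sum_range_two_mul_add_one,
    show 2 * (m + 1) + 2 + 1 = m + 1 + 1 + 1 + 1 + m + 1 by ring, sum_range_succ,
    sum_range_add _ (m + 1 + 1 + 1 + 1), sum_range_succ, sum_range_succ, sum_range_succ,
    show 2 * (m + 1) - 1 = 2 * m + 1 by omega, sum_range_two_mul_add_one]
  have h1 : ∀ i ∈ range (m + 1), (if 2 * i ∈ {k ∈ range (4 * (m + 1) + 4) |
      Even k ∧ (k ≤ 2 * (m + 1) - 2 ∨ 2 * (m + 1) + 5 ≤ k)}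
        then N (2 * i % (2 * (m + 1) + 5)) else M (2 * i)) = N (2 * i) := fun i hi => by
    rw [mem_range] at hi
    rw [if_pos, Nat.mod_eq_of_lt (by omega)]
    simp only [mem_filter, mem_range, even_two, Even.mul_right, true_and]
    omega
  have h2 : ∀ i ∈ range m, (if 2 * (m + 1 + 1 + 1 + 1 + i) ∈ {k ∈ range (4 * (m + 1) + 4) |
      Even k ∧ (k ≤ 2 * (m + 1) - 2 ∨ 2 * (m + 1) + 5 ≤ k)}
        then N (2 * (m + 1 + 1 + 1 + 1 + i) % (2 * (m + 1) + 5))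
        else M (2 * (m + 1 + 1 + 1 + 1 + i))) = N (2 * i + 1) := fun i hi => by
    rw [mem_range] at hi
    rw [if_pos, Nat.mod_eq_sub_mod (by omega), Nat.mod_eq_of_lt (by omega)]
    · congr 1; omega
    simp only [mem_filter, mem_range, even_two, Even.mul_right, true_and]
    omega
  have h3 : ∀ i ∈ range (2 * (m + 1) + 2), (if 2 * i + 1 ∈ {k ∈ range (4 * (m + 1) + 4) |
      Even k ∧ (k ≤ 2 * (m + 1) - 2 ∨ 2 * (m + 1) + 5 ≤ k)}
        then N ((2 * i + 1) % (2 * (m + 1) + 5)) else M (2 * i + 1)) = M (2 * i + 1) :=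
    fun i hi => if_neg fun h => by
      have := (mem_filter.1 h).2.1
      rw [Nat.even_iff] at this
      omega
  rw [sum_congr rfl h1, sum_congr rfl h2, sum_congr rfl h3]
  rw [if_neg, if_neg, if_neg, if_neg]
  · rw [show 2 * (m + 1 + 1) = 2 * (m + 1) + 2 by ring,
      show 2 * (m + 1 + 1 + 1) = 2 * (m + 1) + 4 by ring,
      show 2 * (m + 1 + 1 + 1 + 1 + m) = 4 * (m + 1) + 4 by ring]
    ring
  all_goals
    simp only [mem_filter, mem_range]
    omega

theorem sum_ite_replace_low {n : ℕ} (hn : 0 < n) (M N : ℕ → ℤ) :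
    ∑ k ∈ range (4 * n + 5),
        (if k ∈ {k ∈ range (4 * n + 4) | 2 * n + 5 ≤ k} then N (k % (2 * n + 5)) else M k) =
      ∑ k ∈ range (2 * n + 5), M k + M (4 * n + 4) + ∑ k ∈ range (2 * n - 1), N k := by
  rw [show 4 * n + 5 = 2 * n + 5 + (2 * n - 1) + 1 by omega, sum_range_succ, sum_range_add]
  have h1 : ∀ k ∈ range (2 * n + 5), (if k ∈ {k ∈ range (4 * n + 4) | 2 * n + 5 ≤ k}
      then N (k % (2 * n + 5)) else M k) = M k := fun k hk => if_neg fun h => by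
    rw [mem_range] at hk
    have := (mem_filter.1 h).2
    omega
  have h2 : ∀ k ∈ range (2 * n - 1),
      (if 2 * n + 5 + k ∈ {k ∈ range (4 * n + 4) | 2 * n + 5 ≤ k}
        then N ((2 * n + 5 + k) % (2 * n + 5)) else M (2 * n + 5 + k)) = N k := fun k hk => by
    rw [mem_range] at hk
    rw [if_pos, Nat.add_mod_left, Nat.mod_eq_of_lt (by omega)]
    simp only [mem_filter, mem_range]
    omega
  rw [sum_congr rfl h1, sum_congr rfl h2, if_neg,
    show 2 * n + 5 + (2 * n - 1) = 4 * n + 4 by omega]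
  · ring
  · simp only [mem_filter, mem_range]
    omega

theorem exists_replacement {n : ℕ} (hn : 2 ≤ n) {M N P l y : ℕ → ℤ}
    (hM : ∀ i j, i ≤ 2 * n + 2 → j ≤ 2 * n + 2 → M (i + j) ≤ l i + l j)
    (hN : ∀ i j, i < n → j < n → N (i + j) ≤ y i + y j)
    (hP : ∀ i j, i ≤ 2 * n + 2 → j < n → P (i + j) ≤ l i + y j)
    (h0 : ∑ i ∈ range (2 * n + 3), l i + ∑ j ∈ range n, y j = 0) :
    ∃ U : Finset ℕ, (∀ k ∈ U, k ≤ 2 * n - 2 ∨ 2 * n + 5 ≤ k ∧ k ≤ 4 * n + 3) ∧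
      (∀ k ∈ U, k + (2 * n + 5) ∉ U) ∧
      ∑ k ∈ range (4 * n + 5), (if k ∈ U then N (k % (2 * n + 5)) else M k)
        + ∑ k ∈ range (3 * n + 2), P k ≤ 0 := by
  by_contra! hU
  have w1 := hU ∅ (by simp) (by simp)
  have w2 := hU {k ∈ range (4 * n + 4) | Even k ∧ (k ≤ 2 * n - 2 ∨ 2 * n + 5 ≤ k)}
    (fun k hk => by simp only [mem_filter, mem_range] at hk; omega)
    (fun k hk hk' => by
      simp only [mem_filter, mem_range, Nat.even_iff] at hk hk'
      omega)
  have w3 := hU {k ∈ range (4 * n + 4) | 2 * n + 5 ≤ k}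
    (fun k hk => by simp only [mem_filter, mem_range] at hk; omega)
    (fun k hk hk' => by
      simp only [mem_filter, mem_range] at hk hk'
      omega)
  rw [sum_ite_replace_odd (by omega)] at w2
  rw [sum_ite_replace_low (by omega)] at w3
  simp only [notMem_empty, if_false] at w1
  have b1 := sum_le_staircase (2 * n + 2) hM
  have b2 := sum_le_star (2 * n + 2) hM
  rw [show 2 * (2 * n + 2) + 1 = 4 * n + 5 by ring] at b1 b2
  have b3 := mul_sum_odd_le hM (by omega)
  have b4 := mul_sum_low_le hM (by omega)
  have b5 := mul_sum_mixed_le hP (by omega)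
  have b6 := sum_le_staircase (n - 1) fun i j hi hj => hN i j (by omega) (by omega)
  have b7 := sum_le_star (n - 1) fun i j hi hj => hN i j (by omega) (by omega)
  rw [show 2 * (n - 1) + 1 = 2 * n - 1 by omega, show n - 1 + 1 = n by omega] at b6 b7
  rw [show 2 * n + 2 + 1 = 2 * n + 3 by ring] at b1 b2
  rw [Nat.cast_sub (by omega)] at b7
  push_cast at b2 b7
  generalize ∑ k ∈ range (4 * n + 5), M k = W at *
  generalize ∑ i ∈ range (2 * n + 2), M (2 * i + 1) + M (2 * n) + M (2 * n + 2) + M (2 * n + 4)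
    + M (4 * n + 4) = Q at *
  generalize ∑ k ∈ range (2 * n + 5), M k + M (4 * n + 4) = L at *
  generalize ∑ k ∈ range (2 * n - 1), N k = T at *
  generalize ∑ k ∈ range (3 * n + 2), P k = O at *
  generalize ∑ i ∈ range (2 * n + 3), l i = A at *
  obtain rfl : A = -∑ j ∈ range n, y j := by linarith
  generalize ∑ j ∈ range n, y j = Y at *
  generalize l 0 = a at *
  generalize l (2 * n + 2) = b at *
  generalize y 0 = c at *
  generalize y (n - 1) = d at *
  clear hU hM hN hP h0
  obtain ⟨m, rfl⟩ : ∃ m, n = m + 2 := ⟨n - 2, by omega⟩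
  push_cast at *
  generalize hx : (m : ℤ) = x at *
  have hx0 : 0 ≤ x := by omega
  clear hx hn
  have q1 := mul_pos (show 0 < 7 * (x + 2) ^ 2 * (2 * x + 5) * (2 * x + 7) * (2 * x + 9)
    by positivity) w1
  have q2 := mul_pos (show 0 < (5 * x + 4) * (2 * x + 5) * (2 * x + 7) * (2 * x ^ 2 + 11 * x + 12)
    by positivity) w2
  have q3 := mul_pos (show 0 < (5 * x + 4) * (2 * x + 6) * (2 * x + 5) * (2 * x + 7)
    by positivity) w3
  have p1 := mul_le_mul_of_nonneg_left b1 (show 0 ≤ (2 * x + 9) *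
    (28 * x ^ 4 + 264 * x ^ 3 + 937 * x ^ 2 + 1474 * x + 852) by positivity)
  have p2 := mul_le_mul_of_nonneg_left b2 (show 0 ≤ 2 * (2 * x + 9) *
    (8 * x ^ 3 + 46 * x ^ 2 + 89 * x + 64) by positivity)
  have p3 := mul_le_mul_of_nonneg_left b3
    (show 0 ≤ (5 * x + 4) * (2 * x ^ 2 + 11 * x + 12) by positivity)
  have p4 := mul_le_mul_of_nonneg_left b4 (show 0 ≤ 2 * (5 * x + 4) * (2 * x + 7) by positivity)
  have p5 := mul_le_mul_of_nonneg_left b5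
    (show 0 ≤ 6 * (x + 2) * (2 * x + 3) * (2 * x + 7) * (2 * x + 9) by positivity)
  have p6 := mul_le_mul_of_nonneg_left b6
    (show 0 ≤ (2 * x + 7) * (2 * x + 9) * (x + 1) * (x + 2) * (10 * x + 1) by positivity)
  have p7 := mul_le_mul_of_nonneg_left b7
    (show 0 ≤ 6 * (2 * x + 3) * (2 * x + 7) * (2 * x + 9) * (x + 1)
      + (5 * x + 4) * (2 * x + 5) * (2 * x + 7) * (2 * x + 9) by positivity)
  linarith

section Curve

open Polynomial

theorem wW_sq (g : ℕ) : wW g ^ 2 = zW g ^ (2 * g + 1) + 1 := by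
  rw [← sub_eq_zero, ← sub_sub]
  exact Ideal.Quotient.eq_zero_iff_mem.2 (Ideal.subset_span rfl)

theorem exists_algHom_eval (g : ℕ) {t s : ℂ} (h : s ^ 2 = t ^ (2 * g + 1) + 1) :
    ∃ φ : WRing g →ₐ[ℂ] ℂ, φ (zW g) = t ∧ φ (wW g) = s := by
  refine ⟨Ideal.Quotient.liftₐ _ (MvPolynomial.aeval ![t, s]) fun a ha => ?_, ?_, ?_⟩
  · rw [← RingHom.mem_ker]
    refine (Ideal.span_le.2 ?_) ha
    rintro _ rfl
    simp [RingHom.mem_ker, h]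
  · exact (MvPolynomial.aeval_X _ _).trans rfl
  · exact (MvPolynomial.aeval_X _ _).trans rfl

/-- The map `(p, q) ↦ p(z) + q(z) * w`. -/
def curveMap (g : ℕ) : ℂ[X] × ℂ[X] →ₗ[ℂ] WRing g :=
  (aeval (zW g)).toLinearMap.coprod
    (LinearMap.mulRight ℂ (wW g) ∘ₗ (aeval (zW g)).toLinearMap)

theorem curveMap_apply (g : ℕ) (p q : ℂ[X]) :
    curveMap g (p, q) = aeval (zW g) p + aeval (zW g) q * wW g := rfl

theorem ker_curveMap (g : ℕ) : LinearMap.ker (curveMap g) = ⊥ := by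
  rw [LinearMap.ker_eq_bot']
  rintro ⟨p, q⟩ h
  rw [curveMap_apply] at h
  have key : ∀ t s : ℂ, s ^ 2 = t ^ (2 * g + 1) + 1 → p.eval t + q.eval t * s = 0 := by
    intro t s hs
    obtain ⟨φ, hz, hw⟩ := exists_algHom_eval g hs
    have := congrArg φ h
    rwa [map_add, map_mul, ← aeval_algHom_apply, ← aeval_algHom_apply, hz, hw, map_zero,
      coe_aeval_eq_eval] at this
  have hsqrt : ∀ t : ℂ, ∃ s : ℂ, s ^ 2 = t ^ (2 * g + 1) + 1 := fun t =>
    IsAlgClosed.exists_pow_nat_eq _ two_pos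
  have hp : p = 0 := Polynomial.funext fun t => by
    obtain ⟨s, hs⟩ := hsqrt t
    have h1 := key t s hs
    have h2 := key t (-s) (by rw [neg_sq, hs])
    rw [eval_zero]
    linear_combination (h1 + h2) / 2
  have hq : q * (X ^ (2 * g + 1) + C 1) = 0 := Polynomial.funext fun t => by
    obtain ⟨s, hs⟩ := hsqrt t
    have h1 := key t s hs
    rw [hp, eval_zero, zero_add] at h1
    simp only [eval_mul, eval_add, eval_pow, eval_X, eval_C, eval_zero, ← hs]
    linear_combination s * h1
  rw [mul_eq_zero, or_iff_left (X_pow_add_C_ne_zero (Nat.succ_pos _) 1)] at hq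
  rw [hp, hq, Prod.mk_zero_zero]

/-- The basis `1, z, …, z ^ (r - 1), w, z * w, …, z ^ (s - 1) * w`. -/
def curveMonomial (g r s : ℕ) : Fin r ⊕ Fin s → WRing g :=
  Sum.elim (fun k => zW g ^ (k : ℕ)) (fun k => zW g ^ (k : ℕ) * wW g)

theorem linearIndependent_curveMonomial (g r s : ℕ) :
    LinearIndependent ℂ (curveMonomial g r s) := by
  have hX (m : ℕ) : LinearIndependent ℂ (fun k : Fin m => (X ^ (k : ℕ) : ℂ[X])) := by
    have := (basisMonomials ℂ).linearIndependent.comp _ (Fin.val_injective (n := m))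
    simpa [Function.comp_def, coe_basisMonomials, monomial_one_right_eq_X_pow] using this
  have := (linearIndependent_inl_union_inr' (hX r) (hX s)).map' _ (ker_curveMap g)
  have h : curveMonomial g r s = curveMap g ∘ Sum.elim
      (LinearMap.inl ℂ ℂ[X] ℂ[X] ∘ fun k : Fin r => X ^ (k : ℕ))
      (LinearMap.inr ℂ ℂ[X] ℂ[X] ∘ fun k : Fin s => X ^ (k : ℕ)) := by
    ext (k | k) <;> simp [curveMonomial, curveMap_apply]
  rw [h]
  exact this

end Curve

section Monomials

variable {g : ℕ}

/-- The degree-two monomial with the given factors. -/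
def pairMon (a b : WIdx g) : WDegMon g 2 := ⟨{a, b}, rfl⟩

theorem prod_pairMon (a b : WIdx g) :
    ((pairMon a b).1.map (varW g)).prod = varW g a * varW g b := by
  simp [pairMon]

theorem sum_pairMon (f : WIdx g → ℤ) (a b : WIdx g) :
    ((pairMon a b).1.map f).sum = f a + f b := by
  simp [pairMon]

theorem varW_inl_mul_inl (i j : Fin (2 * g - 1)) :
    varW g (.inl i) * varW g (.inl j) = zW g ^ (i + j : ℕ) :=
  (pow_add _ _ _).symm

theorem varW_inl_mul_inr (i : Fin (2 * g - 1)) (j : Fin (g - 2)) :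
    varW g (.inl i) * varW g (.inr j) = zW g ^ (i + j : ℕ) * wW g := by
  simp only [varW, Sum.elim_inl, Sum.elim_inr]
  ring

theorem varW_inr_mul_inr (i j : Fin (g - 2)) :
    varW g (.inr i) * varW g (.inr j) =
      zW g ^ (i + j + (2 * g + 1) : ℕ) + zW g ^ (i + j : ℕ) := by
  simp only [varW, Sum.elim_inr]
  linear_combination zW g ^ (i + j : ℕ) * wW_sq g

theorem VW_two_le (hg : 2 ≤ g) :
    VW g 2 ≤ Submodule.span ℂ (Set.range (curveMonomial g (4 * g - 3) (3 * g - 4))) := by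
  have hz {k : ℕ} (hk : k < 4 * g - 3) : zW g ^ k ∈
      Submodule.span ℂ (Set.range (curveMonomial g (4 * g - 3) (3 * g - 4))) :=
    Submodule.subset_span ⟨.inl ⟨k, hk⟩, rfl⟩
  have hw {k : ℕ} (hk : k < 3 * g - 4) : zW g ^ k * wW g ∈
      Submodule.span ℂ (Set.range (curveMonomial g (4 * g - 3) (3 * g - 4))) :=
    Submodule.subset_span ⟨.inr ⟨k, hk⟩, rfl⟩
  refine Submodule.span_le.2 ?_
  rintro _ ⟨σ, hσ, rfl⟩
  obtain ⟨a, b, rfl⟩ := Multiset.card_eq_two.1 hσ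
  change ((pairMon a b).1.map (varW g)).prod ∈ _
  rw [prod_pairMon]
  rcases a with i | i <;> rcases b with j | j
  · rw [varW_inl_mul_inl]
    exact hz (by omega)
  · rw [varW_inl_mul_inr]
    exact hw (by omega)
  · rw [mul_comm (varW g _), varW_inl_mul_inr]
    exact hw (by omega)
  · rw [varW_inr_mul_inr]
    exact add_mem (hz (by omega)) (hz (by omega))

theorem prod_mem_VW {m : ℕ} (σ : WDegMon g m) : (σ.1.map (varW g)).prod ∈ VW g m :=
  Submodule.subset_span ⟨σ.1, σ.2, rfl⟩

theorem injective_and_isMonBasisW {c : Fin (4 * g - 3) ⊕ Fin (3 * g - 4) → WDegMon g 2}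
    (hg : 2 ≤ g)
    (hc : ∀ i, curveMonomial g (4 * g - 3) (3 * g - 4) i ∈
      Submodule.span ℂ (Set.range fun i => ((c i).1.map (varW g)).prod)) :
    Function.Injective c ∧
      ∀ S : Finset (WDegMon g 2), (∀ σ, σ ∈ S ↔ ∃ i, c i = σ) → IsMonBasisW g 2 S := by
  set v : Fin (4 * g - 3) ⊕ Fin (3 * g - 4) → WRing g :=
    fun i => ((c i).1.map (varW g)).prod with hv
  have hle : Submodule.span ℂ (Set.range (curveMonomial g (4 * g - 3) (3 * g - 4))) ≤
      Submodule.span ℂ (Set.range v) :=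
    Submodule.span_le.2 (Set.range_subset_iff.2 hc)
  have hspan : Submodule.span ℂ (Set.range v) = VW g 2 :=
    le_antisymm (Submodule.span_le.2 (Set.range_subset_iff.2 fun i => prod_mem_VW (c i)))
      ((VW_two_le hg).trans hle)
  have hli : LinearIndependent ℂ v := by
    rw [linearIndependent_iff_card_le_finrank_span]
    rw [← finrank_span_eq_card (linearIndependent_curveMonomial g (4 * g - 3) (3 * g - 4))]
    have : FiniteDimensional ℂ (Submodule.span ℂ (Set.range v)) :=
      FiniteDimensional.span_of_finite ℂ (Set.finite_range v)
    exact Submodule.finrank_mono hle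
  refine ⟨fun i j hij => hli.injective (by simp only [hv, hij]), fun S hS => ⟨?_, ?_⟩⟩
  · choose f hf using fun s : S => (hS s).1 s.2
    have hf_inj : Function.Injective f := fun s t hst => by
      rw [← Subtype.coe_inj, ← hf, ← hf, hst]
    convert hli.comp f hf_inj using 2 with s
    simp only [hv, Function.comp_apply, hf]
  · rw [← hspan]
    congr 1
    ext r
    constructor
    · rintro ⟨σ, hσ, rfl⟩
      obtain ⟨i, rfl⟩ := (hS σ).1 hσ
      exact ⟨i, rfl⟩
    · rintro ⟨i, rfl⟩
      exact ⟨c i, (hS _).2 ⟨i, rfl⟩, rfl⟩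

theorem isMonBasisW_of_replacement (hg : 3 ≤ g) {U : Finset ℕ}
    (hU : ∀ k ∈ U, k ≤ 2 * (g - 2) - 2 ∨ 2 * g + 1 ≤ k ∧ k ≤ 4 * (g - 2) + 3)
    (hU' : ∀ k ∈ U, k + (2 * g + 1) ∉ U)
    {c : Fin (4 * g - 3) ⊕ Fin (3 * g - 4) → WDegMon g 2}
    (hxx : ∀ k : Fin (4 * g - 3), (k : ℕ) ∉ U →
      ((c (.inl k)).1.map (varW g)).prod = zW g ^ (k : ℕ))
    (hyy : ∀ k : Fin (4 * g - 3), (k : ℕ) ∈ U → ((c (.inl k)).1.map (varW g)).prod =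
      zW g ^ (k % (2 * g + 1) + (2 * g + 1)) + zW g ^ (k % (2 * g + 1)))
    (hxy : ∀ k : Fin (3 * g - 4), ((c (.inr k)).1.map (varW g)).prod = zW g ^ (k : ℕ) * wW g) :
    Function.Injective c ∧
      ∀ S : Finset (WDegMon g 2), (∀ σ, σ ∈ S ↔ ∃ i, c i = σ) → IsMonBasisW g 2 S := by
  refine injective_and_isMonBasisW (by omega) ?_
  have hmem (i) : ((c i).1.map (varW g)).prod ∈
      Submodule.span ℂ (Set.range fun i => ((c i).1.map (varW g)).prod) :=
    Submodule.subset_span ⟨i, rfl⟩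
  have hz {k : ℕ} (hk : k < 4 * g - 3) (hkU : k ∉ U) : zW g ^ k ∈
      Submodule.span ℂ (Set.range fun i => ((c i).1.map (varW g)).prod) :=
    hxx ⟨k, hk⟩ hkU ▸ hmem _
  rintro (k | k)
  · change zW g ^ (k : ℕ) ∈ _
    by_cases hk : (k : ℕ) ∈ U
    · have h1 := hmem (.inl k)
      rw [hyy k hk] at h1
      rcases hU k hk with h | h
      · rw [Nat.mod_eq_of_lt (by omega)] at h1
        exact (add_mem_cancel_left (hz (k := k + (2 * g + 1)) (by omega) (hU' _ hk))).1 h1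
      · rw [Nat.mod_eq_sub_mod h.1, Nat.mod_eq_of_lt (by omega), Nat.sub_add_cancel h.1] at h1
        refine (add_mem_cancel_right (hz (k := k - (2 * g + 1)) (by omega) fun h2 => ?_)).1 h1
        have := hU' _ h2
        rw [Nat.sub_add_cancel h.1] at this
        exact this hk
    · exact hz k.2 hk
  · change zW g ^ (k : ℕ) * wW g ∈ _
    exact hxy k ▸ hmem _

end Monomials

theorem exists_min_pair {p q : ℕ} (hp : 0 < p) (hq : 0 < q) (f : Fin p → ℤ) (f' : Fin q → ℤ)
    (k : ℕ) : ∃ (i : Fin p) (j : Fin q), k + 2 ≤ p + q → (i + j : ℕ) = k ∧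
      ∀ (i' : Fin p) (j' : Fin q), (i' + j' : ℕ) = k → f i + f' j ≤ f i' + f' j' := by
  by_cases hk : k + 2 ≤ p + q
  · have hne : (univ.filter fun x : Fin p × Fin q => (x.1 + x.2 : ℕ) = k).Nonempty :=
      ⟨(⟨min k (p - 1), by omega⟩, ⟨k - min k (p - 1), by omega⟩), by simp⟩
    obtain ⟨⟨i, j⟩, hij, hmin⟩ := exists_min_image _ (fun x => f x.1 + f' x.2) hne
    exact ⟨i, j, fun _ => ⟨by simpa using hij, fun i' j' h => hmin (i', j') (by simpa using h)⟩⟩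
  · exact ⟨⟨0, hp⟩, ⟨0, hq⟩, fun h => absurd h hk⟩

/-- Extension by zero of a finite family to all of `ℕ`. -/
def extendZero {p : ℕ} (f : Fin p → ℤ) (i : ℕ) : ℤ := if h : i < p then f ⟨i, h⟩ else 0

theorem extendZero_of_lt {p : ℕ} (f : Fin p → ℤ) {i : ℕ} (h : i < p) :
    extendZero f i = f ⟨i, h⟩ := dif_pos h

theorem sum_range_extendZero {p : ℕ} (f : Fin p → ℤ) :
    ∑ i ∈ range p, extendZero f i = ∑ i, f i := by
  rw [sum_range]
  exact sum_congr rfl fun i _ => extendZero_of_lt f i.2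

/-- Combinatorial content of Corollary 5.12. -/
theorem wiman_second_semistable (g : ℕ) (hg : 4 ≤ g)
    (lam : Fin (2 * g - 1) → ℤ) (nu : Fin (g - 2) → ℤ)
    (hsum : (∑ i, lam i) + (∑ j, nu j) = 0) :
    ∃ S : Finset (WDegMon g 2), IsMonBasisW g 2 S ∧
      (∑ σ ∈ S, (σ.1.map (Sum.elim lam nu)).sum) ≤ 0 := by
  choose xa xb hx using exists_min_pair (by omega) (by omega) lam lam
  choose ya yb hy using exists_min_pair (by omega) (by omega) nu nu
  choose za zb hz using exists_min_pair (by omega) (by omega) lam nu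
  have hle {p q k i j : ℕ} {f : Fin p → ℤ} {f' : Fin q → ℤ} {a : Fin p} {b : Fin q}
      (h : k + 2 ≤ p + q → (a + b : ℕ) = k ∧
        ∀ (i' : Fin p) (j' : Fin q), (i' + j' : ℕ) = k → f a + f' b ≤ f i' + f' j')
      (hk : i + j = k) (hi : i < p) (hj : j < q) :
      f a + f' b ≤ extendZero f i + extendZero f' j := by
    rw [extendZero_of_lt f hi, extendZero_of_lt f' hj]
    exact (h (by omega)).2 _ _ hk
  obtain ⟨U, hU, hU', hw⟩ := exists_replacement (n := g - 2) (by omega)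
    (M := fun k => lam (xa k) + lam (xb k)) (N := fun k => nu (ya k) + nu (yb k))
    (P := fun k => lam (za k) + nu (zb k)) (l := extendZero lam) (y := extendZero nu)
    (fun i j hi hj => hle (hx (i + j)) rfl (by omega) (by omega))
    (fun i j hi hj => hle (hy (i + j)) rfl (by omega) (by omega))
    (fun i j hi hj => hle (hz (i + j)) rfl (by omega) (by omega))
    (by rw [show 2 * (g - 2) + 3 = 2 * g - 1 by omega, sum_range_extendZero,
      sum_range_extendZero, hsum])
  rw [show 2 * (g - 2) + 5 = 2 * g + 1 by omega] at hU hU' hw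
  rw [show 4 * (g - 2) + 5 = 4 * g - 3 by omega, show 3 * (g - 2) + 2 = 3 * g - 4 by omega] at hw
  let c : Fin (4 * g - 3) ⊕ Fin (3 * g - 4) → WDegMon g 2 := Sum.elim
    (fun k => if (k : ℕ) ∈ U
      then pairMon (.inr (ya (k % (2 * g + 1)))) (.inr (yb (k % (2 * g + 1))))
      else pairMon (.inl (xa k)) (.inl (xb k)))
    (fun k => pairMon (.inl (za k)) (.inr (zb k)))
  have hc := isMonBasisW_of_replacement (c := c) (by omega) hU hU'
    (fun k hk => by
      simp only [c, Sum.elim_inl, if_neg hk]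
      rw [prod_pairMon, varW_inl_mul_inl, (hx k (by omega)).1])
    (fun k hk => by
      have hk' : k % (2 * g + 1) + 2 ≤ g - 2 + (g - 2) := by
        rcases hU k hk with h | h
        · rw [Nat.mod_eq_of_lt (by omega)]
          omega
        · rw [Nat.mod_eq_sub_mod h.1, Nat.mod_eq_of_lt (by omega)]
          omega
      simp only [c, Sum.elim_inl, if_pos hk]
      rw [prod_pairMon, varW_inr_mul_inr, (hy _ hk').1])
    (fun k => by
      simp only [c, Sum.elim_inr]
      rw [prod_pairMon, varW_inl_mul_inr, (hz k (by omega)).1])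
  refine ⟨univ.map ⟨c, hc.1⟩, hc.2 _ (by simp), le_of_eq_of_le ?_ hw⟩
  rw [sum_map, Fintype.sum_sum_type, sum_range, sum_range]
  congr 1
  · refine sum_congr rfl fun k _ => ?_
    simp only [c, Function.Embedding.coeFn_mk, Sum.elim_inl]
    split_ifs
    exacts [sum_pairMon _ _ _, sum_pairMon _ _ _]
  · exact sum_congr rfl fun k _ => sum_pairMon _ _ _

end
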